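/- Let C₀ ≥ 1, M ≥ 1, D ≥ 3, and let A be sufficiently large depending on C₀. Let Ψ: H → ℝ^D be a smooth map with Ψ(0) = 0 satisfying: C₀^{−1}M ≤ |XΨ(0)|, |YΨ(0)| ≤ C₀M; |ZΨ(0)| ≤ C₀ and |W₁W₂Ψ(0)| ≤ C₀ for all W₁, W₂ ∈ {X,Y,Z}; |W₁W₂W₃Ψ(p)| ≤ C₀ for all p ∈ H and all W₁, W₂, W₃ ∈ {X,Y,Z}; and |XΨ(0) ∧ YΨ(0) ∧ ZΨ(0)| ≥ C₀^{−1}M². Then there is a constant c(C₀) > 0 such that |Ψ(p)| ≥ c(C₀)·A^{−0.2} for every p ∈ H with A^{−0.1} ≤ d(p,0) ≤ 2·A^{−0.1}. -/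

import Mathlib

open scoped ENNReal NNReal RealInnerProductSpace BigOperators

noncomputable section

/-- The Heisenberg group `H`, identified as a set with `ℝ³`. -/
abbrev H : Type := ℝ × ℝ × ℝ

namespace Heisenberg

/-- The group law `[a,b,c]·[x,y,z] = [x+a, y+b, z+c+a·y]`. -/
def mul (p q : H) : H := (q.1 + p.1, q.2.1 + p.2.1, q.2.2 + p.2.2 + p.1 * q.2.1)

/-- The group inverse `[x,y,z]⁻¹ = [−x,−y,−z+xy]`. -/
def inv (p : H) : H := (-p.1, -p.2.1, -p.2.2 + p.1 * p.2.1)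

/-- Membership in the integer lattice `Γ`. -/
def inGamma (p : H) : Prop :=
  (∃ a : ℤ, p.1 = (a : ℝ)) ∧ (∃ b : ℤ, p.2.1 = (b : ℝ)) ∧ (∃ c : ℤ, p.2.2 = (c : ℝ))

/-- Flow along the vector field `X`: `exp(tX)[x,y,z] = [x+t, y, z+t·y]`. -/
def flowX (t : ℝ) (p : H) : H := (p.1 + t, p.2.1, p.2.2 + t * p.2.1)

/-- Flow along the vector field `Y`: `exp(tY)[x,y,z] = [x, y+t, z]`. -/
def flowY (t : ℝ) (p : H) : H := (p.1, p.2.1 + t, p.2.2)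

def flow : Bool → ℝ → H → H
  | true => flowX
  | false => flowY

/-- `applyFlows [(W₁,t₁),…,(W_k,t_k)] p = exp(t₁W₁)⋯exp(t_kW_k) p`. -/
def applyFlows : List (Bool × ℝ) → H → H
  | [], p => p
  | wt :: l, p => flow wt.1 wt.2 (applyFlows l p)

/-- The Carnot–Carathéodory metric on `H`. -/
def ccDist (p p' : H) : ℝ :=
  sInf { s | ∃ l : List (Bool × ℝ), applyFlows l p = p' ∧ s = (l.map fun wt => |wt.2|).sum }

/-- The parabolic dilation `δ_λ[x,y,z] = [λx, λy, λ²z]`. -/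
def dilate (lam : ℝ) (p : H) : H := (lam * p.1, lam * p.2.1, lam ^ 2 * p.2.2)

variable {E : Type*} [NormedAddCommGroup E] [NormedSpace ℝ E]

/-- The right-invariant vector field `X = ∂/∂x + y ∂/∂z` acting on functions. -/
def XD (φ : H → E) : H → E := fun p => fderiv ℝ φ p (1, 0, p.2.1)

/-- The right-invariant vector field `Y = ∂/∂y` acting on functions. -/
def YD (φ : H → E) : H → E := fun p => fderiv ℝ φ p (0, 1, 0)

/-- The vector field `Z = ∂/∂z` acting on functions. -/
def ZD (φ : H → E) : H → E := fun p => fderiv ℝ φ p (0, 0, 1)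

def WD : Bool → (H → E) → H → E
  | true => XD
  | false => YD

/-- `X`, `Y`, `Z` indexed by `Fin 3`. -/
def WD3 : Fin 3 → (H → E) → H → E := ![XD, YD, ZD]

/-- The pointwise (Euclidean) norm `|∇^j φ(p)|` of the `j`-th iterated horizontal
gradient `∇^jφ`, computed via the words of length `j` in `X, Y`. -/
def gradNorm (j : ℕ) (φ : H → E) (p : H) : ℝ :=
  Real.sqrt (∑ w : Fin j → Bool, ‖(List.ofFn w).foldr WD φ p‖ ^ 2)

/-- `‖∇^m φ‖_{C^k_R}`, valued in `ℝ≥0∞`. -/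
def CkRS (m k : ℕ) (R : ℝ) (φ : H → E) : ℝ≥0∞ :=
  ∑ j ∈ Finset.range (k + 1),
    ENNReal.ofReal (R ^ j) * ⨆ p : H, ENNReal.ofReal (gradNorm (m + j) φ p)

/-- The homogeneous Hölder seminorm `‖∇^m φ‖_{Ċ^{0,α}}`, valued in `ℝ≥0∞`. -/
def gradHolderS (m : ℕ) (α : ℝ) (φ : H → E) : ℝ≥0∞ :=
  ⨆ (p : H) (q : H) (_ : p ≠ q),
    ENNReal.ofReal (Real.sqrt (∑ w : Fin m → Bool,
        ‖(List.ofFn w).foldr WD φ p - (List.ofFn w).foldr WD φ q‖ ^ 2)) /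
      ENNReal.ofReal (ccDist p q ^ α)

/-- `‖∇^m φ‖_{C^{k,α}_R}`, valued in `ℝ≥0∞`. -/
def CkAS (m k : ℕ) (α R : ℝ) (φ : H → E) : ℝ≥0∞ :=
  CkRS m k R φ + ENNReal.ofReal (R ^ ((k : ℝ) + α)) * gradHolderS (m + k) α φ

/-- `‖φ‖_{C^k_R}`. -/
abbrev CkR (k : ℕ) (R : ℝ) (φ : H → E) : ℝ≥0∞ := CkRS 0 k R φ

/-- `‖φ‖_{C^{k,α}_R}`. -/
abbrev CkA (k : ℕ) (α R : ℝ) (φ : H → E) : ℝ≥0∞ := CkAS 0 k α R φ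

/-- A dyadic number is one of the form `2^m`, `m ∈ ℤ`. -/
def IsDyadic (A : ℝ) : Prop := ∃ m : ℤ, A = 2 ^ m

/-- The norm `|v₁ ∧ ⋯ ∧ v_k|` of a wedge product of vectors of `ℝ^D`, via the
Cauchy–Binet (Gram determinant) formula. -/
def wedgeNorm {D k : ℕ} (v : Fin k → EuclideanSpace ℝ (Fin D)) : ℝ :=
  Real.sqrt (Matrix.det (Matrix.of fun i j => ⟪v i, v j⟫))

end Heisenberg

open Heisenberg

namespace Heisenberg

section Gram

variable {D : ℕ}

lemma wedgeNorm_three (x y z : EuclideanSpace ℝ (Fin D)) :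
    wedgeNorm ![x, y, z] = √(⟪x, x⟫ * ⟪y, y⟫ * ⟪z, z⟫ + 2 * ⟪x, y⟫ * ⟪y, z⟫ * ⟪x, z⟫
      - ⟪x, x⟫ * ⟪y, z⟫ ^ 2 - ⟪y, y⟫ * ⟪x, z⟫ ^ 2 - ⟪z, z⟫ * ⟪x, y⟫ ^ 2) := by
  unfold wedgeNorm
  congr 1
  rw [Matrix.det_fin_three]
  simp only [Matrix.of_apply, Matrix.cons_val_zero, Matrix.cons_val_one, Matrix.cons_val]
  rw [real_inner_comm x y, real_inner_comm x z, real_inner_comm y z]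
  ring

/-- Hadamard's inequality for three vectors. -/
lemma wedgeNorm_three_le (x y z : EuclideanSpace ℝ (Fin D)) :
    wedgeNorm ![x, y, z] ≤ ‖x‖ * ‖y‖ * ‖z‖ := by
  rw [wedgeNorm_three]
  refine Real.sqrt_le_iff.2 ⟨by positivity, ?_⟩
  simp only [real_inner_self_eq_norm_sq]
  have h1 : 2 * ⟪x, y⟫ * ⟪y, z⟫ * ⟪x, z⟫ ≤ 2 * (‖x‖ * ‖y‖) * (|⟪y, z⟫| * |⟪x, z⟫|) := by
    calc 2 * ⟪x, y⟫ * ⟪y, z⟫ * ⟪x, z⟫ ≤ |2 * ⟪x, y⟫ * ⟪y, z⟫ * ⟪x, z⟫| := le_abs_self _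
      _ = 2 * |⟪x, y⟫| * (|⟪y, z⟫| * |⟪x, z⟫|) := by
        rw [abs_mul, abs_mul, abs_mul, abs_two]; ring
      _ ≤ _ := by
        have := abs_real_inner_le_norm x y
        gcongr
  have h2 := sq_nonneg (‖x‖ * |⟪y, z⟫| - ‖y‖ * |⟪x, z⟫|)
  have h3 := sq_abs ⟪y, z⟫
  have h4 := sq_abs ⟪x, z⟫
  have h5 : 0 ≤ ‖z‖ ^ 2 * ⟪x, y⟫ ^ 2 := by positivity
  rw [← h3, ← h4]
  nlinarith

lemma wedgeNorm_swap_left (x y z : EuclideanSpace ℝ (Fin D)) :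
    wedgeNorm ![y, x, z] = wedgeNorm ![x, y, z] := by
  rw [wedgeNorm_three, wedgeNorm_three, real_inner_comm x y]
  congr 1
  ring

lemma wedgeNorm_swap_outer (x y z : EuclideanSpace ℝ (Fin D)) :
    wedgeNorm ![z, y, x] = wedgeNorm ![x, y, z] := by
  rw [wedgeNorm_three, wedgeNorm_three, real_inner_comm y z, real_inner_comm x z,
    real_inner_comm x y]
  congr 1
  ring

lemma wedgeNorm_linear_combination (a b c : ℝ) (x y z : EuclideanSpace ℝ (Fin D)) :
    wedgeNorm ![a • x + b • y + c • z, y, z] = |a| * wedgeNorm ![x, y, z] := by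
  rw [wedgeNorm_three, wedgeNorm_three, ← Real.sqrt_sq_eq_abs, ← Real.sqrt_mul (sq_nonneg a)]
  congr 1
  simp only [inner_add_left, inner_add_right, real_inner_smul_left, real_inner_smul_right]
  rw [real_inner_comm x y, real_inner_comm x z, real_inner_comm y z]
  ring

lemma abs_mul_wedgeNorm_le (a b c : ℝ) (x y z : EuclideanSpace ℝ (Fin D)) :
    |a| * wedgeNorm ![x, y, z] ≤ ‖a • x + b • y + c • z‖ * ‖y‖ * ‖z‖ := by
  rw [← wedgeNorm_linear_combination a b c]
  exact wedgeNorm_three_le _ _ _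

/-- Quantitative linear independence of three vectors with a large wedge product. -/
lemma coeff_sum_le {C₀ M : ℝ} (hC₀ : 1 ≤ C₀) (hM : 1 ≤ M) {x y z : EuclideanSpace ℝ (Fin D)}
    (hx : ‖x‖ ≤ C₀ * M) (hy : ‖y‖ ≤ C₀ * M) (hz : ‖z‖ ≤ C₀)
    (hw : C₀⁻¹ * M ^ 2 ≤ wedgeNorm ![x, y, z]) (a b c : ℝ) :
    |a| + |b| + |c| ≤ 3 * C₀ ^ 3 * ‖a • x + b • y + c • z‖ := by
  have hC : 0 < C₀ := by linarith
  have hM0 : 0 < M := by linarith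
  set v := a • x + b • y + c • z with hv
  have key : ∀ {s P Q : ℝ}, |s| * wedgeNorm ![x, y, z] ≤ ‖v‖ * P * Q → 0 ≤ P → 0 ≤ Q →
      P * Q ≤ C₀ ^ 2 * M ^ 2 → |s| ≤ C₀ ^ 3 * ‖v‖ := by
    intro s P Q h hP hQ hPQ
    have h1 : |s| * (C₀⁻¹ * M ^ 2) ≤ ‖v‖ * (C₀ ^ 2 * M ^ 2) := by
      calc |s| * (C₀⁻¹ * M ^ 2) ≤ |s| * wedgeNorm ![x, y, z] := by gcongr
        _ ≤ ‖v‖ * (P * Q) := by rw [← mul_assoc]; exact h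
        _ ≤ _ := by gcongr
    have h2 : |s| * (C₀⁻¹ * M ^ 2) * (C₀ / M ^ 2) ≤ ‖v‖ * (C₀ ^ 2 * M ^ 2) * (C₀ / M ^ 2) := by
      gcongr
    have h3 : |s| * (C₀⁻¹ * M ^ 2) * (C₀ / M ^ 2) = |s| := by field_simp
    have h4 : ‖v‖ * (C₀ ^ 2 * M ^ 2) * (C₀ / M ^ 2) = C₀ ^ 3 * ‖v‖ := by field_simp
    rwa [h3, h4] at h2
  have hz' : ‖z‖ ≤ C₀ * M := hz.trans (le_mul_of_one_le_right hC.le hM)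
  have hmul : ∀ {P Q : ℝ}, 0 ≤ Q → P ≤ C₀ * M → Q ≤ C₀ * M → P * Q ≤ C₀ ^ 2 * M ^ 2 := by
    intro P Q hQ h1 h2
    calc P * Q ≤ (C₀ * M) * (C₀ * M) := by gcongr
      _ = _ := by ring
  have ha := key (abs_mul_wedgeNorm_le a b c x y z) (norm_nonneg _) (norm_nonneg _)
    (hmul (norm_nonneg _) hy hz')
  have hb : |b| ≤ C₀ ^ 3 * ‖v‖ := by
    have h := abs_mul_wedgeNorm_le b a c y x z
    rw [wedgeNorm_swap_left, add_comm (b • y)] at h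
    exact key h (norm_nonneg _) (norm_nonneg _) (hmul (norm_nonneg _) hx hz')
  have hc : |c| ≤ C₀ ^ 3 * ‖v‖ := by
    have h := abs_mul_wedgeNorm_le c b a z y x
    rw [wedgeNorm_swap_outer, show c • z + b • y + a • x = v by rw [hv]; abel] at h
    exact key h (norm_nonneg _) (norm_nonneg _) (hmul (norm_nonneg _) hy hx)
  linarith

end Gram

section Distance

/-- The `Z`-component of `p` in exponential coordinates. -/
def expZ (p : H) : ℝ := p.2.2 - p.1 * p.2.1 / 2

/-- The `ℓ¹` norm of `p` in exponential coordinates. -/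
def expNorm (p : H) : ℝ := |p.1| + |p.2.1| + |expZ p|

lemma abs_flow_le (w : Bool) (t : ℝ) (p : H) :
    |p.1| + |p.2.1| ≤ |(flow w t p).1| + |(flow w t p).2.1| + |t| := by
  cases w
  · have := abs_sub_abs_le_abs_sub (p.2.1) (p.2.1 + t)
    rw [sub_add_cancel_left, abs_neg] at this
    simp only [flow, flowY]
    linarith
  · have := abs_sub_abs_le_abs_sub (p.1) (p.1 + t)
    rw [sub_add_cancel_left, abs_neg] at this
    simp only [flow, flowX]
    linarith

lemma abs_expZ_flow_le (w : Bool) (t : ℝ) (p : H) :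
    |expZ p| ≤ |expZ (flow w t p)| + |t| * (|(flow w t p).1| + |(flow w t p).2.1|) := by
  have aux : ∀ u v s : ℝ, |u - v| = |s| / 2 → |u| ≤ |v| + |s| := fun u v s h => by
    linarith [abs_sub_abs_le_abs_sub u v, abs_nonneg s]
  cases w
  · have h := aux (expZ p) (expZ (flow false t p)) (t * p.1) (by
      simp only [expZ, flow, flowY]
      rw [← abs_two (α := ℝ), ← abs_div]; congr 1; ring)
    rw [abs_mul] at h
    have h' : |t| * |p.1| ≤ |t| * (|(flow false t p).1| + |(flow false t p).2.1|) := by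
      gcongr
      simp only [flow, flowY]
      linarith [abs_nonneg (p.2.1 + t)]
    linarith
  · have h := aux (expZ p) (expZ (flow true t p)) (t * p.2.1) (by
      simp only [expZ, flow, flowX]
      rw [← abs_neg, ← abs_two (α := ℝ), ← abs_div]; congr 1; ring)
    rw [abs_mul] at h
    have h' : |t| * |p.2.1| ≤ |t| * (|(flow true t p).1| + |(flow true t p).2.1|) := by
      gcongr
      simp only [flow, flowX]
      linarith [abs_nonneg (p.1 + t)]
    linarith

lemma applyFlows_bounds (l : List (Bool × ℝ)) (p : H) :
    |p.1| + |p.2.1| ≤ |(applyFlows l p).1| + |(applyFlows l p).2.1|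
        + (l.map fun wt => |wt.2|).sum ∧
      |expZ p| ≤ |expZ (applyFlows l p)| + (l.map fun wt => |wt.2|).sum *
        (|(applyFlows l p).1| + |(applyFlows l p).2.1| + (l.map fun wt => |wt.2|).sum) := by
  induction l with
  | nil => simp [applyFlows]
  | cons wt l ih =>
    obtain ⟨ih₁, ih₂⟩ := ih
    simp only [applyFlows, List.map_cons, List.sum_cons]
    have h₁ := abs_flow_le wt.1 wt.2 (applyFlows l p)
    have h₂ := abs_expZ_flow_le wt.1 wt.2 (applyFlows l p)
    set m := applyFlows l p
    set q := flow wt.1 wt.2 m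
    have hs : 0 ≤ (l.map fun wt => |wt.2|).sum := by
      apply List.sum_nonneg
      simp only [List.mem_map]
      rintro _ ⟨a, -, rfl⟩
      exact abs_nonneg _
    set s := (l.map fun wt => |wt.2|).sum
    have ht := abs_nonneg wt.2
    set t := |wt.2|
    refine ⟨by linarith, ?_⟩
    have h₃ := mul_le_mul_of_nonneg_left h₁ hs
    have h₄ := mul_nonneg ht ht
    have h₅ := mul_nonneg ht hs
    nlinarith

lemma expNorm_le_of_ccDist_lt {p : H} {s : ℝ} (h0 : 0 < ccDist p 0) (h : ccDist p 0 < s) :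
    expNorm p ≤ s + s ^ 2 := by
  have hne : { s | ∃ l : List (Bool × ℝ),
      applyFlows l p = 0 ∧ s = (l.map fun wt => |wt.2|).sum }.Nonempty := by
    by_contra hemp
    rw [Set.not_nonempty_iff_eq_empty] at hemp
    rw [ccDist, hemp, Real.sInf_empty] at h0
    exact lt_irrefl _ h0
  obtain ⟨_, ⟨l, hl, rfl⟩, hlt⟩ := exists_lt_of_csInf_lt hne h
  obtain ⟨h₁, h₂⟩ := applyFlows_bounds l p
  rw [hl] at h₁ h₂
  simp only [expZ, Prod.fst_zero, Prod.snd_zero, abs_zero, zero_add, mul_zero, zero_div,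
    sub_zero] at h₁ h₂
  have hs : 0 ≤ (l.map fun wt => |wt.2|).sum := le_trans (by positivity) h₁
  unfold expNorm expZ
  nlinarith

lemma ccDist_zero_le (p : H) :
    ccDist p 0 ≤ |p.1| + |p.2.1| + 4 * √|p.2.2 - p.1 * p.2.1| := by
  obtain ⟨x, y, z⟩ := p
  set w := z - x * y with hw
  have hbdd : BddBelow { s | ∃ l : List (Bool × ℝ),
      applyFlows l (x, y, z) = 0 ∧ s = (l.map fun wt => |wt.2|).sum } := by
    refine ⟨0, ?_⟩
    rintro _ ⟨l, -, rfl⟩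
    apply List.sum_nonneg
    simp only [List.mem_map]
    rintro _ ⟨a, -, rfl⟩
    exact abs_nonneg _
  obtain ⟨t, ht, htw⟩ : ∃ t : ℝ, |t| = √|w| ∧ √|w| * t = w := by
    rcases le_total 0 w with h | h
    · exact ⟨√|w|, abs_of_nonneg (Real.sqrt_nonneg _), by
        rw [Real.mul_self_sqrt (abs_nonneg _), abs_of_nonneg h]⟩
    · exact ⟨-√|w|, by rw [abs_neg, abs_of_nonneg (Real.sqrt_nonneg _)], by
        rw [mul_neg, Real.mul_self_sqrt (abs_nonneg _), abs_of_nonpos h, neg_neg]⟩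
  refine csInf_le hbdd ⟨[(false, -t), (true, -√|w|), (false, t), (true, √|w|), (false, -y),
    (true, -x)], ?_, ?_⟩
  · simp only [applyFlows, flow, flowX, flowY]
    refine Prod.ext ?_ (Prod.ext ?_ ?_)
    · simp
    · simp
    · simp only [Prod.snd_zero]
      linear_combination hw - htw
  · simp only [List.map_cons, List.map_nil, List.sum_cons, List.sum_nil, abs_neg, ht,
      abs_of_nonneg (Real.sqrt_nonneg |w|)]
    ring

lemma sq_ccDist_le {p : H} (h : expNorm p ≤ 1) (h0 : 0 ≤ ccDist p 0) :
    ccDist p 0 ^ 2 ≤ 49 * expNorm p := by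
  have hd := ccDist_zero_le p
  set T := expNorm p with hT
  have hTdef : T = |p.1| + |p.2.1| + |expZ p| := rfl
  have hx := abs_nonneg p.1
  have hy := abs_nonneg p.2.1
  have hz := abs_nonneg (expZ p)
  have hT0 : 0 ≤ T := by rw [hTdef]; positivity
  have hw : |p.2.2 - p.1 * p.2.1| ≤ (3 / 2) ^ 2 * T := by
    have h1 : p.2.2 - p.1 * p.2.1 = expZ p - p.1 * p.2.1 / 2 := by unfold expZ; ring
    have h2 := abs_sub (expZ p) (p.1 * p.2.1 / 2)
    rw [abs_div, abs_mul, abs_two] at h2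
    rw [h1]
    nlinarith
  have hsq : √|p.2.2 - p.1 * p.2.1| ≤ 3 / 2 * √T := by
    calc _ ≤ √((3 / 2) ^ 2 * T) := Real.sqrt_le_sqrt hw
      _ = _ := by rw [Real.sqrt_mul (by positivity), Real.sqrt_sq (by norm_num)]
  have hTs : T ≤ √T := Real.le_sqrt_of_sq_le (by nlinarith)
  have hle : ccDist p 0 ≤ 7 * √T := by linarith
  calc ccDist p 0 ^ 2 ≤ (7 * √T) ^ 2 := by gcongr
    _ = 49 * T := by rw [mul_pow, Real.sq_sqrt hT0]; norm_num

end Distance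

section Taylor

variable {E : Type*} [NormedAddCommGroup E] [NormedSpace ℝ E]

lemma contDiff_WD3 {φ : H → E} (hφ : ContDiff ℝ (⊤ : ℕ∞) φ) (i : Fin 3) :
    ContDiff ℝ (⊤ : ℕ∞) (WD3 i φ) := by
  have hf : ContDiff ℝ (⊤ : ℕ∞) (fderiv ℝ φ) := hφ.fderiv_right le_rfl
  fin_cases i
  · change ContDiff ℝ _ (fun p : H => fderiv ℝ φ p (1, 0, p.2.1))
    exact hf.clm_apply (by fun_prop)
  · change ContDiff ℝ _ (fun p : H => fderiv ℝ φ p (0, 1, 0))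
    exact hf.clm_apply (by fun_prop)
  · change ContDiff ℝ _ (fun p : H => fderiv ℝ φ p (0, 0, 1))
    exact hf.clm_apply (by fun_prop)

/-- The integral curve through `0` of the field `k 0 • X + k 1 • Y + k 2 • Z`. -/
def expCurve (k : Fin 3 → ℝ) (t : ℝ) : H :=
  (t * k 0, t * k 1, t * k 2 + t ^ 2 * (k 0 * k 1 / 2))

lemma hasDerivAt_expCurve (k : Fin 3 → ℝ) (t : ℝ) :
    HasDerivAt (expCurve k) (k 0, k 1, k 2 + k 0 * (expCurve k t).2.1) t := by
  have h : ∀ s : ℝ, HasDerivAt (fun t : ℝ => t * s) s t := fun s => by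
    simpa using (hasDerivAt_id t).mul_const s
  refine (h _).prodMk ((h _).prodMk ?_)
  refine ((h (k 2)).add ((hasDerivAt_pow 2 t).mul_const (k 0 * k 1 / 2))).congr_deriv ?_
  simp only [expCurve]
  push_cast
  ring

lemma hasDerivAt_comp_expCurve {φ : H → E} (hφ : Differentiable ℝ φ) (k : Fin 3 → ℝ) (t : ℝ) :
    HasDerivAt (fun t => φ (expCurve k t)) (∑ i, k i • WD3 i φ (expCurve k t)) t := by
  refine ((hφ (expCurve k t)).hasFDerivAt.comp_hasDerivAt t
    (hasDerivAt_expCurve k t)).congr_deriv ?_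
  simp only [Fin.sum_univ_three, WD3, XD, YD, ZD, Matrix.cons_val_zero, Matrix.cons_val_one,
    Matrix.cons_val, ← map_smul, ← map_add]
  congr 1
  simp
  ring

lemma norm_sum_smul_le (k : Fin 3 → ℝ) {u : Fin 3 → E} {B : ℝ} (h : ∀ i, ‖u i‖ ≤ B) :
    ‖∑ i, k i • u i‖ ≤ (∑ i, |k i|) * B := by
  rw [Finset.sum_mul]
  refine norm_sum_le_of_le _ fun i _ => ?_
  rw [norm_smul, Real.norm_eq_abs]
  exact mul_le_mul_of_nonneg_left (h i) (abs_nonneg _)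

lemma norm_sub_le_of_hasDerivAt {f f' : ℝ → E} {B : ℝ} (hf : ∀ t, HasDerivAt f (f' t) t)
    (hB : ∀ t ∈ Set.Icc (0 : ℝ) 1, ‖f' t‖ ≤ B) {t : ℝ} (ht : t ∈ Set.Icc (0 : ℝ) 1) :
    ‖f t - f 0‖ ≤ B := by
  have h := norm_image_sub_le_of_norm_deriv_le_segment' (f := f) (f' := f') (C := B)
    (fun x _ => (hf x).hasDerivWithinAt) (fun x hx => hB x (Set.Ico_subset_Icc_self hx)) t ht
  have hB0 : 0 ≤ B := (norm_nonneg _).trans (hB t ht)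
  nlinarith [ht.1, ht.2]

/-- First order Taylor expansion at `0` in exponential coordinates. -/
lemma norm_sub_linear_le {C : ℝ} {φ : H → E} (hφ : ContDiff ℝ (⊤ : ℕ∞) φ) (h0 : φ 0 = 0)
    (h2 : ∀ i j : Fin 3, ‖WD3 i (WD3 j φ) 0‖ ≤ C)
    (h3 : ∀ p : H, ∀ i j l : Fin 3, ‖WD3 i (WD3 j (WD3 l φ)) p‖ ≤ C) (k : Fin 3 → ℝ) :
    ‖φ (expCurve k 1) - ∑ i, k i • WD3 i φ 0‖ ≤
      (∑ i, |k i|) ^ 2 * (C + (∑ i, |k i|) * C) := by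
  have hne : ((⊤ : ℕ∞) : WithTop ℕ∞) ≠ 0 := by simp
  have hγ : expCurve k 0 = 0 := by simp [expCurve]
  set S := ∑ i, |k i| with hS
  have bound₂ : ∀ t ∈ Set.Icc (0 : ℝ) 1, ∀ i j, ‖WD3 i (WD3 j φ) (expCurve k t)‖ ≤ C + S * C := by
    intro t ht i j
    have h := norm_sub_le_of_hasDerivAt (hasDerivAt_comp_expCurve
      ((contDiff_WD3 (contDiff_WD3 hφ j) i).differentiable hne) k)
      (fun t _ => norm_sum_smul_le k fun l => h3 (expCurve k t) l i j) ht
    rw [hγ] at h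
    have := norm_le_norm_add_norm_sub' (WD3 i (WD3 j φ) (expCurve k t)) (WD3 i (WD3 j φ) 0)
    linarith [h2 i j]
  have bound₁ : ∀ t ∈ Set.Icc (0 : ℝ) 1, ∀ j,
      ‖WD3 j φ (expCurve k t) - WD3 j φ 0‖ ≤ S * (C + S * C) := by
    intro t ht j
    have h := norm_sub_le_of_hasDerivAt (hasDerivAt_comp_expCurve
      ((contDiff_WD3 hφ j).differentiable hne) k)
      (fun t ht => norm_sum_smul_le k fun l => bound₂ t ht l j) ht
    rwa [hγ] at h
  have hd : ∀ t, HasDerivAt (fun t => φ (expCurve k t) - t • ∑ i, k i • WD3 i φ 0)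
      (∑ i, k i • (WD3 i φ (expCurve k t) - WD3 i φ 0)) t := by
    intro t
    refine ((hasDerivAt_comp_expCurve (hφ.differentiable hne) k t).sub
      ((hasDerivAt_id t).smul_const (∑ i, k i • WD3 i φ 0))).congr_deriv ?_
    simp [smul_sub]
  have h := norm_sub_le_of_hasDerivAt hd
    (fun t ht => norm_sum_smul_le k (bound₁ t ht)) (Set.right_mem_Icc.2 zero_le_one)
  simp only [hγ, h0, one_smul, zero_smul, sub_zero] at h
  rwa [← mul_assoc, ← sq] at h

end Taylor

end Heisenberg

/-- **The Taylor-expansion lower bound** (from Section 4 of the paper): if `Ψ(0) = 0`,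
the first derivatives of `Ψ` at `0` are of size `≍ M` and span well
(`|XΨ(0) ∧ YΨ(0) ∧ ZΨ(0)| ≥ C₀⁻¹M²`), and the second derivatives at `0` and third
derivatives everywhere are `O(C₀)`, then `|Ψ(p)| ≳_{C₀} A^{-0.2}` whenever
`A^{-0.1} ≤ d(p,0) ≤ 2A^{-0.1}`. -/
theorem statement19 (C₀ : ℝ) (hC₀ : 1 ≤ C₀) :
    ∃ c : ℝ, 0 < c ∧
      ∃ A₀ : ℝ, 1 ≤ A₀ ∧
        ∀ A : ℝ, A₀ ≤ A →
          ∀ M : ℝ, 1 ≤ M →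
            ∀ D : ℕ, 3 ≤ D →
              ∀ Ψ : H → EuclideanSpace ℝ (Fin D), ContDiff ℝ (⊤ : ℕ∞) Ψ →
                Ψ 0 = 0 →
                (C₀⁻¹ * M ≤ ‖XD Ψ 0‖ ∧ ‖XD Ψ 0‖ ≤ C₀ * M) →
                (C₀⁻¹ * M ≤ ‖YD Ψ 0‖ ∧ ‖YD Ψ 0‖ ≤ C₀ * M) →
                ‖ZD Ψ 0‖ ≤ C₀ →
                (∀ i j : Fin 3, ‖WD3 i (WD3 j Ψ) 0‖ ≤ C₀) →
                (∀ p : H, ∀ i j l : Fin 3, ‖WD3 i (WD3 j (WD3 l Ψ)) p‖ ≤ C₀) →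
                C₀⁻¹ * M ^ 2 ≤ wedgeNorm ![XD Ψ 0, YD Ψ 0, ZD Ψ 0] →
                ∀ p : H, A ^ (-(0.1 : ℝ)) ≤ ccDist p 0 → ccDist p 0 ≤ 2 * A ^ (-(0.1 : ℝ)) →
                  c * A ^ (-(0.2 : ℝ)) ≤ ‖Ψ p‖ := by
  have hC : 0 < C₀ := by linarith
  refine ⟨1 / (294 * C₀ ^ 3), by positivity, (144 * C₀ ^ 4) ^ (10 : ℝ), ?_, ?_⟩
  · exact Real.one_le_rpow (by nlinarith [one_le_pow₀ hC₀ (n := 4)]) (by norm_num)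
  intro A hA M hM D _ Ψ hΨ hΨ0 hX hY hZ h2 h3 hw p hp₁ hp₂
  have hA0 : 0 < A := lt_of_lt_of_le (by positivity) hA
  have hr : 0 < A ^ (-(0.1 : ℝ)) := Real.rpow_pos_of_pos hA0 _
  have hr2 : A ^ (-(0.2 : ℝ)) = (A ^ (-(0.1 : ℝ))) ^ 2 := by
    rw [← Real.rpow_natCast, ← Real.rpow_mul hA0.le]; norm_num
  have hrsmall : A ^ (-(0.1 : ℝ)) * (144 * C₀ ^ 4) ≤ 1 := by
    have h : 144 * C₀ ^ 4 ≤ A ^ (0.1 : ℝ) := by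
      calc 144 * C₀ ^ 4 = ((144 * C₀ ^ 4) ^ (10 : ℝ)) ^ (0.1 : ℝ) := by
            rw [← Real.rpow_mul (by positivity)]; norm_num
        _ ≤ _ := Real.rpow_le_rpow (by positivity) hA (by norm_num)
    calc _ ≤ A ^ (-(0.1 : ℝ)) * A ^ (0.1 : ℝ) := by gcongr
      _ = 1 := by rw [← Real.rpow_add hA0]; norm_num
  rw [hr2]
  set r := A ^ (-(0.1 : ℝ))
  have hC4 : 1 ≤ C₀ ^ 4 := one_le_pow₀ hC₀
  have hr1 : r ≤ 1 := by nlinarith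
  have hT := expNorm_le_of_ccDist_lt (hr.trans_le hp₁) (show ccDist p 0 < 3 * r by linarith)
  set T := expNorm p with hTdef
  have hT12 : T ≤ 12 * r := by nlinarith
  have hTC : 12 * C₀ ^ 4 * T ≤ 1 := by nlinarith
  have hT0 : 0 ≤ T := by rw [hTdef]; unfold expNorm; positivity
  have hT1 : T ≤ 1 := by nlinarith
  have hlow : r ^ 2 ≤ 49 * T :=
    le_trans (by gcongr) (sq_ccDist_le hT1 (hr.le.trans hp₁))
  set k : Fin 3 → ℝ := ![p.1, p.2.1, expZ p] with hk
  have hkp : expCurve k 1 = p := by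
    refine Prod.ext ?_ (Prod.ext ?_ ?_) <;> simp [expCurve, hk, expZ]
  have hkS : ∑ i, |k i| = T := by simp [Fin.sum_univ_three, hk, hTdef, expNorm]
  have hmain := norm_sub_linear_le hΨ hΨ0 h2 h3 k
  rw [hkp, hkS, Fin.sum_univ_three] at hmain
  have hv := coeff_sum_le hC₀ hM hX.2 hY.2 hZ hw p.1 p.2.1 (expZ p)
  change T ≤ _ at hv
  change ‖Ψ p - (p.1 • XD Ψ 0 + p.2.1 • YD Ψ 0 + expZ p • ZD Ψ 0)‖ ≤ _ at hmain
  set v := p.1 • XD Ψ 0 + p.2.1 • YD Ψ 0 + expZ p • ZD Ψ 0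
  have htri : ‖v‖ ≤ ‖Ψ p‖ + ‖Ψ p - v‖ := norm_le_norm_add_norm_sub _ _
  have herr : T ^ 2 * (C₀ + T * C₀) ≤ 2 * C₀ * T ^ 2 := by
    have h : T * C₀ ≤ C₀ := mul_le_of_le_one_left hC.le hT1
    nlinarith [mul_le_mul_of_nonneg_left h (sq_nonneg T)]
  have herr' : 6 * C₀ ^ 3 * ‖Ψ p - v‖ ≤ T := by
    calc 6 * C₀ ^ 3 * ‖Ψ p - v‖ ≤ 6 * C₀ ^ 3 * (2 * C₀ * T ^ 2) := by
          gcongr; exact hmain.trans herr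
      _ = 12 * C₀ ^ 4 * T * T := by ring
      _ ≤ T := mul_le_of_le_one_left hT0 hTC
  have hfin : T ≤ 6 * C₀ ^ 3 * ‖Ψ p‖ := by
    have := mul_le_mul_of_nonneg_left htri (show 0 ≤ 6 * C₀ ^ 3 by positivity)
    linarith
  rw [one_div, inv_mul_le_iff₀ (by positivity)]
  linarith
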